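/- arXiv:0903.0459 — 2 statements merged into one kernel-verified Lean document; each statement's English description precedes it below -/
import Mathlib

section
/- Let X ⊆ ℝ be compact, let f : X → X be continuous, and let μ be an f-invariant Borel probability measure on X (not necessarily ergodic). Then the Kolmogorov–Sinai entropy does not exceed the permutation entropy: h_μ(f) ≤ h*_μ(f). -/
open MeasureTheory Filter Set Function
open scoped Classical ENNReal Topology

noncomputable section

/-- `ordIdx f d l x` is the inversion number `i_{d,l}(x)`, the `l`-th entry of the
ordinal pattern of order `d` realized by `x`:
`i_{d,l}(x) = #{r ∈ {0,…,l-1} : f^[d-r] x ≤ f^[d-l] x}`. -/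
def ordIdx {X : Set ℝ} (f : X → X) (d l : ℕ) (x : X) : ℕ :=
  ((Finset.range l).filter (fun r => f^[d - r] x ≤ f^[d - l] x)).card

/-- The partition `P_d = {P_i : i ∈ I_d}` of `X` into the sets of points realizing the
same ordinal pattern of order `d`, where an ordinal pattern `i ∈ I_d = ∏_{l=1}^d {0,…,l}`
is encoded as a dependent function `i : ∀ l : Fin d, Fin (l+2)` (so that `i l` is the
entry `i_{l+1} ∈ {0,…,l+1}`). -/
def patPartition {X : Set ℝ} (f : X → X) (d : ℕ) : Finset (Set X) :=
  Finset.image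
    (fun i : (∀ l : Fin d, Fin (l.val + 2)) =>
      {x : X | ∀ l : Fin d, ordIdx f d (l.val + 1) x = (i l).val})
    Finset.univ

/-- `𝒜` is a finite partition of `X` into Borel sets. -/
def IsFinPartition {X : Set ℝ} (𝒜 : Finset (Set X)) : Prop :=
  (∀ A ∈ 𝒜, MeasurableSet A) ∧
  (∀ A ∈ 𝒜, ∀ B ∈ 𝒜, A ≠ B → Disjoint A B) ∧
  ⋃₀ (𝒜 : Set (Set X)) = Set.univ

/-- The Shannon entropy `H(𝒜) = -∑_{A ∈ 𝒜} μ(A) ln μ(A)` of a finite partition `𝒜`. -/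
def partEntropy {X : Set ℝ} (μ : Measure X) (𝒜 : Finset (Set X)) : ℝ :=
  ∑ A ∈ 𝒜, Real.negMulLog (μ A).toReal

/-- The common refinement `⋁_{j=0}^{n-1} f^{-∘j}(𝒜)`, i.e. the partition of `X` into the
nonempty intersections `⋂_{j<n} f^{-∘j}(A_j)` with `A_j ∈ 𝒜`; it is the (unique up to
empty sets) partition generating the σ-algebra `⋁_{j=0}^{n-1} f^{-∘j}(𝒜)`. -/
def dynRefine {X : Set ℝ} (f : X → X) (𝒜 : Finset (Set X)) : ℕ → Finset (Set X)
  | 0 => {Set.univ}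
  | n + 1 =>
      ((dynRefine f 𝒜 n) ×ˢ (𝒜.image fun A => f^[n] ⁻¹' A)).image fun p => p.1 ∩ p.2

/-- `h_μ(f,𝒜) = lim_{n→∞} (1/n) H(⋁_{j=0}^{n-1} f^{-∘j}(𝒜))` (the limit exists and is
here expressed as a `limsup`). -/
def dynEntropy {X : Set ℝ} (μ : Measure X) (f : X → X) (𝒜 : Finset (Set X)) : ℝ :=
  Filter.limsup (fun n : ℕ => partEntropy μ (dynRefine f 𝒜 n) / n) Filter.atTop

/-- The Kolmogorov-Sinai entropy `h_μ(f) = sup {h_μ(f,𝒜) : 𝒜 finite Borel partition}`,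
as an extended nonnegative real. -/
def ksEntropy {X : Set ℝ} (μ : Measure X) (f : X → X) : ℝ≥0∞ :=
  ⨆ (𝒜 : Finset (Set X)) (_ : IsFinPartition 𝒜), ENNReal.ofReal (dynEntropy μ f 𝒜)

/-- The permutation entropy `h*_μ(f) = limsup_{d→∞} (1/d) H(P_d)`, as an extended
nonnegative real. -/
def permEntropy {X : Set ℝ} (μ : Measure X) (f : X → X) : ℝ≥0∞ :=
  Filter.limsup
    (fun d : ℕ => ENNReal.ofReal (partEntropy μ (patPartition f d)) / (d : ℝ≥0∞))
    Filter.atTop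

section Entropy

variable {Ω ι κ : Type*} [MeasurableSpace Ω]

/-- All fibres of `g` are measurable sets. -/
def FiberMeasurable (g : Ω → ι) : Prop := ∀ i, MeasurableSet (g ⁻¹' {i})

/-- The Shannon entropy of the partition of `Ω` into the fibres of `g`. -/
def fiberEntropy [Fintype ι] (μ : Measure Ω) (g : Ω → ι) : ℝ :=
  ∑ i, Real.negMulLog (μ.real (g ⁻¹' {i}))

lemma FiberMeasurable.prodMk {g : Ω → ι} {h : Ω → κ} (hg : FiberMeasurable g)
    (hh : FiberMeasurable h) : FiberMeasurable fun x => (g x, h x) := by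
  rintro ⟨i, j⟩
  convert (hg i).inter (hh j) using 1
  ext x
  simp

lemma FiberMeasurable.pi {n : Type*} [Countable n] {κ : n → Type*} {g : ∀ k, Ω → κ k}
    (hg : ∀ k, FiberMeasurable (g k)) : FiberMeasurable fun x k => g k x := by
  intro i
  convert MeasurableSet.iInter fun k => hg k (i k) using 1
  ext x
  simp [funext_iff]

lemma FiberMeasurable.preimage [Finite ι] {g : Ω → ι} (hg : FiberMeasurable g) (S : Set ι) :
    MeasurableSet (g ⁻¹' S) := by
  rw [← Set.biUnion_preimage_singleton]
  exact S.toFinite.measurableSet_biUnion fun i _ => hg i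

lemma FiberMeasurable.comp_measurable {Ω' : Type*} [MeasurableSpace Ω'] {g : Ω → ι}
    (hg : FiberMeasurable g) {f : Ω' → Ω} (hf : Measurable f) :
    FiberMeasurable fun x => g (f x) :=
  fun i => hf (hg i)

lemma FiberMeasurable.of_factorsThrough [Finite κ] {g : Ω → ι} {h : Ω → κ}
    (hh : FiberMeasurable h) (hgh : FactorsThrough g h) : FiberMeasurable g := by
  intro i
  convert hh.preimage (h '' (g ⁻¹' {i})) using 1
  refine Subset.antisymm (subset_preimage_image _ _) ?_
  rintro x ⟨y, hy, hyx⟩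
  exact (hgh hyx).symm.trans hy

/-- The sequence of the first `n` values of `g` along the orbit of `x`. -/
def itinerary {Ω ι : Type*} (f : Ω → Ω) (g : Ω → ι) (n : ℕ) (x : Ω) : Fin n → ι :=
  fun j => g (f^[j] x)

lemma FiberMeasurable.itinerary {f : Ω → Ω} (hf : Measurable f) {g : Ω → ι}
    (hg : FiberMeasurable g) (n : ℕ) : FiberMeasurable (itinerary f g n) :=
  FiberMeasurable.pi fun j => hg.comp_measurable (hf.iterate j)

lemma sum_measureReal_preimage_inter [Fintype ι] (μ : Measure Ω) [IsFiniteMeasure μ] {g : Ω → ι}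
    (hg : FiberMeasurable g) (S : Set Ω) : ∑ i, μ.real (g ⁻¹' {i} ∩ S) = μ.real S := by
  have h := sum_measureReal_preimage_singleton (μ := μ.restrict S) Finset.univ fun i _ => hg i
  simpa [measureReal_restrict_apply (hg _)] using h

lemma sum_measureReal_fiber [Fintype ι] (μ : Measure Ω) [IsProbabilityMeasure μ] {g : Ω → ι}
    (hg : FiberMeasurable g) : ∑ i, μ.real (g ⁻¹' {i}) = 1 := by
  simpa using sum_measureReal_preimage_inter μ hg univ

/-- Gibbs' inequality for a single term. -/
lemma negMulLog_le_mul_neg_log_add {p q : ℝ} (hp : 0 ≤ p) (hq : 0 < q) :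
    Real.negMulLog p ≤ p * -Real.log q + (q - p) := by
  rcases hp.eq_or_lt with rfl | hp
  · simp [hq.le]
  have h := Real.log_le_sub_one_of_pos (div_pos hq hp)
  rw [Real.log_div hq.ne' hp.ne'] at h
  have h' := mul_le_mul_of_nonneg_left h hp.le
  have : p * (q / p - 1) = q - p := by field_simp
  rw [Real.negMulLog]
  linarith

variable [Fintype ι] [Fintype κ]

lemma fiberEntropy_nonneg (μ : Measure Ω) [IsProbabilityMeasure μ] (g : Ω → ι) :
    0 ≤ fiberEntropy μ g :=
  Finset.sum_nonneg fun _ _ => Real.negMulLog_nonneg measureReal_nonneg measureReal_le_one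

lemma fiberEntropy_le_of_factorsThrough (μ : Measure Ω) [IsProbabilityMeasure μ] {g : Ω → ι}
    {h : Ω → κ} (hh : FiberMeasurable h) (hgh : FactorsThrough g h) :
    fiberEntropy μ g ≤ fiberEntropy μ h := by
  obtain ⟨x₀⟩ : Nonempty Ω := nonempty_of_isProbabilityMeasure μ
  let φ : κ → ι := extend h g fun _ => g x₀
  have hφ (x : Ω) : φ (h x) = g x := hgh.extend_apply _ x
  have hpre (i : ι) :
      μ.real (g ⁻¹' {i}) = ∑ j with φ j = i, μ.real (h ⁻¹' {j}) := by
    rw [← sum_measureReal_preimage_inter μ hh (g ⁻¹' {i}), Finset.sum_filter]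
    refine Finset.sum_congr rfl fun j _ => ?_
    split_ifs with hj
    · congr 1
      ext x
      simp only [mem_inter_iff, mem_preimage, mem_singleton_iff, and_iff_left_iff_imp]
      rintro rfl
      rw [← hφ, hj]
    · convert measureReal_empty
      ext x
      simp only [mem_inter_iff, mem_preimage, mem_singleton_iff, mem_empty_iff_false, iff_false,
        not_and]
      rintro rfl
      rwa [← hφ]
  unfold fiberEntropy
  rw [← Finset.sum_fiberwise (s := Finset.univ) (g := φ)]
  refine Finset.sum_le_sum fun i _ => ?_
  rw [Real.negMulLog, neg_mul, ← mul_neg]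
  nth_rewrite 1 [hpre i]
  rw [Finset.sum_mul]
  refine Finset.sum_le_sum fun j hj => ?_
  rw [Real.negMulLog, neg_mul, ← mul_neg]
  rcases (measureReal_nonneg (μ := μ) (s := h ⁻¹' {j})).eq_or_lt with h0 | h0
  · simp [← h0]
  · have : μ.real (h ⁻¹' {j}) ≤ μ.real (g ⁻¹' {i}) := by
      rw [hpre i]
      exact Finset.single_le_sum (f := fun j => μ.real (h ⁻¹' {j}))
        (fun _ _ => measureReal_nonneg) hj
    gcongr

lemma fiberEntropy_prodMk_le (μ : Measure Ω) [IsProbabilityMeasure μ] {g : Ω → ι}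
    {h : Ω → κ} (hg : FiberMeasurable g) (hh : FiberMeasurable h) :
    fiberEntropy μ (fun x => (g x, h x)) ≤ fiberEntropy μ g + fiberEntropy μ h := by
  set p := fun i => μ.real (g ⁻¹' {i}) with hp
  set q := fun j => μ.real (h ⁻¹' {j}) with hq
  set r := fun i j => μ.real (g ⁻¹' {i} ∩ h ⁻¹' {j}) with hr
  have hp1 : ∑ i, p i = 1 := sum_measureReal_fiber μ hg
  have hq1 : ∑ j, q j = 1 := sum_measureReal_fiber μ hh
  have hrp (i : ι) : ∑ j, r i j = p i := by
    simp only [hr, hp, inter_comm (g ⁻¹' {i})]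
    exact sum_measureReal_preimage_inter μ hh _
  have hrq (j : κ) : ∑ i, r i j = q j := sum_measureReal_preimage_inter μ hg _
  have hterm (i : ι) (j : κ) : Real.negMulLog (r i j) ≤
      r i j * -Real.log (p i) + r i j * -Real.log (q j) + (p i * q j - r i j) := by
    have h0 : 0 ≤ r i j := measureReal_nonneg
    rcases h0.eq_or_lt with h0 | h0
    · rw [← h0]
      simpa using mul_nonneg (measureReal_nonneg (μ := μ)) (measureReal_nonneg (μ := μ))
    have hpi : 0 < p i := h0.trans_le (measureReal_mono inter_subset_left)
    have hqj : 0 < q j := h0.trans_le (measureReal_mono inter_subset_right)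
    have := negMulLog_le_mul_neg_log_add h0.le (mul_pos hpi hqj)
    rw [Real.log_mul hpi.ne' hqj.ne'] at this
    linarith
  calc fiberEntropy μ (fun x => (g x, h x)) = ∑ i, ∑ j, Real.negMulLog (r i j) := by
        rw [fiberEntropy, Fintype.sum_prod_type]
        refine Finset.sum_congr rfl fun i _ => Finset.sum_congr rfl fun j _ => ?_
        congr 2
        ext x
        simp
    _ ≤ ∑ i, ∑ j, (r i j * -Real.log (p i) + r i j * -Real.log (q j) + (p i * q j - r i j)) :=
        Finset.sum_le_sum fun i _ => Finset.sum_le_sum fun j _ => hterm i j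
    _ = ∑ i, p i * -Real.log (p i) + ∑ j, q j * -Real.log (q j) := by
        simp only [Finset.sum_add_distrib, Finset.sum_sub_distrib, ← Finset.mul_sum,
          ← Finset.sum_mul, hrp, hq1, mul_one, sub_self, add_zero]
        rw [Finset.sum_comm (f := fun i j => r i j * -Real.log (q j))]
        simp only [← Finset.sum_mul, hrq]
    _ = fiberEntropy μ g + fiberEntropy μ h := by
        simp only [fiberEntropy, Real.negMulLog, neg_mul, mul_neg, hp, hq]

lemma fiberEntropy_le_log_card (μ : Measure Ω) [IsProbabilityMeasure μ] {g : Ω → ι}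
    (hg : FiberMeasurable g) : fiberEntropy μ g ≤ Real.log (Fintype.card ι) := by
  obtain ⟨x₀⟩ : Nonempty Ω := nonempty_of_isProbabilityMeasure μ
  have : Nonempty ι := ⟨g x₀⟩
  have hc : (0 : ℝ) < Fintype.card ι := by exact_mod_cast Fintype.card_pos
  calc fiberEntropy μ g ≤ ∑ i, (μ.real (g ⁻¹' {i}) * -Real.log (Fintype.card ι : ℝ)⁻¹ +
        ((Fintype.card ι : ℝ)⁻¹ - μ.real (g ⁻¹' {i}))) :=
        Finset.sum_le_sum fun i _ =>
          negMulLog_le_mul_neg_log_add measureReal_nonneg (inv_pos.2 hc)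
    _ = Real.log (Fintype.card ι) := by
        rw [Finset.sum_add_distrib, ← Finset.sum_mul, Finset.sum_sub_distrib,
          sum_measureReal_fiber μ hg]
        simp [hc.ne']

lemma fiberEntropy_comp {μ : Measure Ω} {f : Ω → Ω} (hf : MeasurePreserving f μ μ)
    {g : Ω → ι} (hg : FiberMeasurable g) :
    fiberEntropy μ (fun x => g (f x)) = fiberEntropy μ g :=
  Finset.sum_congr rfl fun i _ => by
    rw [← hf.measureReal_preimage (hg i).nullMeasurableSet]
    rfl

lemma fiberEntropy_itinerary_le {μ : Measure Ω} [IsProbabilityMeasure μ] {f : Ω → Ω}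
    (hf : MeasurePreserving f μ μ) {g : Ω → ι} (hg : FiberMeasurable g) (n : ℕ) :
    fiberEntropy μ (itinerary f g n) ≤ n * fiberEntropy μ g := by
  induction n with
  | zero =>
    have := fiberEntropy_le_log_card μ (hg.itinerary hf.measurable 0)
    simpa using this
  | succ n ih =>
    have hgn := hg.comp_measurable (hf.iterate n).measurable
    calc fiberEntropy μ (itinerary f g (n + 1))
        ≤ fiberEntropy μ fun x => (itinerary f g n x, g (f^[n] x)) := by
          refine fiberEntropy_le_of_factorsThrough μ
            ((hg.itinerary hf.measurable n).prodMk hgn) fun x y hxy => ?_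
          rw [Prod.mk.injEq] at hxy
          refine funext fun j => ?_
          refine Fin.lastCases hxy.2 (fun j => congrFun hxy.1 j) j
      _ ≤ fiberEntropy μ (itinerary f g n) + fiberEntropy μ fun x => g (f^[n] x) :=
          fiberEntropy_prodMk_le μ (hg.itinerary hf.measurable n) hgn
      _ ≤ (n + 1 : ℕ) * fiberEntropy μ g := by
          rw [fiberEntropy_comp (hf.iterate n) hg]
          push_cast
          linarith

end Entropy

section Order

variable {α : Type*} [LinearOrder α]

lemma le_iff_le_of_card_eq {l : ℕ} {u v : ℕ → α} {a b : α}
    (huv : ∀ s < l, ∀ r < s, u r ≤ u s ↔ v r ≤ v s)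
    (hcard : ((Finset.range l).filter fun r => u r ≤ a).card =
      ((Finset.range l).filter fun r => v r ≤ b).card) :
    ∀ r < l, u r ≤ a ↔ v r ≤ b := by
  set U := (Finset.range l).filter fun r => u r ≤ a with hU
  set V := (Finset.range l).filter fun r => v r ≤ b with hV
  have hUV : U = V := by
    by_cases h : U ⊆ V
    · exact Finset.eq_of_subset_of_card_le h hcard.ge
    refine (Finset.eq_of_subset_of_card_le (fun s hs => ?_) hcard.le).symm
    obtain ⟨r, hrU, hrV⟩ := Finset.not_subset.1 h
    by_contra hsU
    simp only [hU, hV, Finset.mem_filter, Finset.mem_range, not_and, not_le] at hrU hrV hs hsU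
    have h₁ : u r < u s := hrU.2.trans_lt (hsU hs.1)
    have h₂ : v s < v r := hs.2.trans_lt (hrV hrU.1)
    rcases lt_trichotomy r s with hrs | rfl | hrs
    · exact h₂.not_ge ((huv s hs.1 r hrs).1 h₁.le)
    · exact lt_irrefl _ h₁
    · exact h₁.not_ge ((huv r hrU.1 s hrs).2 h₂.le)
  intro r hr
  have : r ∈ U ↔ r ∈ V := by rw [hUV]
  simpa [hU, hV, hr] using this

lemma le_iff_le_of_code_eq {n : ℕ} {u v : ℕ → α}
    (hcode : ∀ l < n, ((Finset.range l).filter fun r => u r ≤ u l).card =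
      ((Finset.range l).filter fun r => v r ≤ v l).card) :
    ∀ l < n, ∀ r < l, u r ≤ u l ↔ v r ≤ v l := by
  intro l
  induction l using Nat.strong_induction_on with
  | _ l ih =>
    intro hl
    exact le_iff_le_of_card_eq (fun s hs => ih s hs (hs.trans hl)) (hcode l hl)

end Order

section Pattern

variable {X : Set ℝ}

/-- The ordinal pattern of order `d` realized by `x`. -/
def ordPattern (f : X → X) (d : ℕ) (x : X) : ∀ l : Fin d, Fin (l.val + 2) :=
  fun l => ⟨ordIdx f d (l.val + 1) x, Nat.lt_succ_of_le <|
    (Finset.card_filter_le _ _).trans_eq (Finset.card_range _)⟩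

/-- The number of the first `n` points of the orbit of `x` lying below each threshold in `T`. -/
def countBelow (f : X → X) (T : Finset ℝ) (n : ℕ) (x : X) : T → Fin (n + 1) :=
  fun t => ⟨((Finset.range n).filter fun r => (f^[n - 1 - r] x : ℝ) ≤ t).card,
    Nat.lt_succ_of_le <| (Finset.card_filter_le _ _).trans_eq (Finset.card_range _)⟩

/-- The cell of `x` in the partition of `X` into intervals with endpoints in `T`. -/
def thresholdCell (T : Finset ℝ) (x : X) : T → Prop := fun t => (x : ℝ) ≤ t

lemma measurableSet_card_filter_eq {Ω : Type*} [MeasurableSpace Ω] {n : ℕ} {p : ℕ → Ω → Prop}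
    (hp : ∀ r, MeasurableSet {x | p r x}) (k : ℕ) :
    MeasurableSet {x | ((Finset.range n).filter fun r => p r x).card = k} := by
  have : Measurable fun x => ((Finset.range n).filter fun r => p r x).card := by
    simp only [Finset.card_filter]
    exact Finset.measurable_sum _ fun r _ => Measurable.ite (hp r) measurable_const measurable_const
  exact this (measurableSet_singleton k)

lemma fiberMeasurable_ordPattern {f : X → X} (hf : Measurable f) (d : ℕ) :
    FiberMeasurable (ordPattern f d) := by
  refine FiberMeasurable.pi (g := fun l x => ordPattern f d x l) fun l i => ?_
  convert measurableSet_card_filter_eq (n := l.val + 1)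
    (p := fun r x => f^[d - r] x ≤ f^[d - (l.val + 1)] x)
    (fun r => measurableSet_le (hf.iterate _) (hf.iterate _)) i.val using 1
  ext x
  simp [ordPattern, ordIdx, Fin.ext_iff]

lemma fiberMeasurable_countBelow {f : X → X} (hf : Measurable f) (T : Finset ℝ) (n : ℕ) :
    FiberMeasurable (countBelow f T n) := by
  refine FiberMeasurable.pi (g := fun t x => countBelow f T n x t) fun t i => ?_
  convert measurableSet_card_filter_eq (n := n) (p := fun r x => (f^[n - 1 - r] x : ℝ) ≤ t)
    (fun r => measurableSet_le (hf.iterate _).subtype_val measurable_const) i.val using 1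
  ext x
  simp [countBelow, Fin.ext_iff]

lemma fiberMeasurable_thresholdCell (T : Finset ℝ) :
    FiberMeasurable (thresholdCell T : X → T → Prop) := by
  refine FiberMeasurable.pi (g := fun (t : T) (x : X) => (x : ℝ) ≤ t) fun t P => ?_
  have h : MeasurableSet {x : X | (x : ℝ) ≤ t} :=
    measurableSet_le measurable_subtype_coe measurable_const
  by_cases hP : P
  · convert h using 1
    ext x
    simp [hP]
  · convert h.compl using 1
    ext x
    simp [hP]

lemma itinerary_thresholdCell_factorsThrough (f : X → X) (T : Finset ℝ) (d : ℕ) :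
    FactorsThrough (itinerary f (thresholdCell T) d)
      fun x => (ordPattern f d x, countBelow f T (d + 1) x) := by
  intro x y hxy
  rw [Prod.mk.injEq] at hxy
  have hcode : ∀ l < d + 1, ((Finset.range l).filter fun r =>
      (f^[d - r] x : ℝ) ≤ f^[d - l] x).card = ((Finset.range l).filter fun r =>
      (f^[d - r] y : ℝ) ≤ f^[d - l] y).card := by
    rintro (_ | l) hl
    · simp
    · exact congrArg Fin.val (congrFun hxy.1 ⟨l, Nat.lt_of_succ_lt_succ hl⟩)
  funext j t
  have hcount := congrArg Fin.val (congrFun hxy.2 t)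
  have := le_iff_le_of_card_eq
    (u := fun r => (f^[d - r] x : ℝ)) (v := fun r => (f^[d - r] y : ℝ))
    (le_iff_le_of_code_eq hcode) hcount (d - j) (by omega)
  simp only [Nat.sub_sub_self j.isLt.le] at this
  exact propext this

lemma fiberEntropy_itinerary_thresholdCell_le {f : X → X} (hf : Measurable f) (μ : Measure X)
    [IsProbabilityMeasure μ] (T : Finset ℝ) (d : ℕ) :
    fiberEntropy μ (itinerary f (thresholdCell T) d) ≤
      fiberEntropy μ (ordPattern f d) + T.card * Real.log (d + 2) := by
  have hP := fiberMeasurable_ordPattern hf d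
  have hN := fiberMeasurable_countBelow hf T (d + 1)
  calc fiberEntropy μ (itinerary f (thresholdCell T) d)
      ≤ fiberEntropy μ fun x => (ordPattern f d x, countBelow f T (d + 1) x) :=
        fiberEntropy_le_of_factorsThrough μ (hP.prodMk hN)
          (itinerary_thresholdCell_factorsThrough f T d)
    _ ≤ fiberEntropy μ (ordPattern f d) + fiberEntropy μ (countBelow f T (d + 1)) :=
        fiberEntropy_prodMk_le μ hP hN
    _ ≤ _ := by
        gcongr
        refine (fiberEntropy_le_log_card μ hN).trans_eq ?_
        simp only [Fintype.card_pi, Fintype.card_fin, Finset.prod_const, Finset.card_univ,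
          Fintype.card_coe, Nat.cast_pow, Real.log_pow]
        push_cast
        ring_nf

end Pattern

section Approximation

variable {X : Set ℝ}

/-- The measurable sets that are unions of cells of a finite partition of `X` into intervals. -/
def thresholdSets (X : Set ℝ) : Set (Set X) :=
  {E | MeasurableSet E ∧ ∃ T : Finset ℝ, ∀ x y,
    thresholdCell T x = thresholdCell T y → (x ∈ E ↔ y ∈ E)}

lemma thresholdCell_eq_of_subset {S T : Finset ℝ} (hST : S ⊆ T) {x y : X}
    (h : thresholdCell T x = thresholdCell T y) : thresholdCell S x = thresholdCell S y :=
  funext fun t => congrFun h ⟨t, hST t.2⟩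

lemma isSetAlgebra_thresholdSets : IsSetAlgebra (thresholdSets X) where
  empty_mem := ⟨MeasurableSet.empty, ∅, by simp⟩
  compl_mem := by
    rintro E ⟨hE, T, hT⟩
    exact ⟨hE.compl, T, fun x y hxy => not_congr (hT x y hxy)⟩
  union_mem := by
    rintro E F ⟨hE, S, hS⟩ ⟨hF, T, hT⟩
    exact ⟨hE.union hF, S ∪ T, fun x y hxy =>
      or_congr (hS x y (thresholdCell_eq_of_subset Finset.subset_union_left hxy))
        (hT x y (thresholdCell_eq_of_subset Finset.subset_union_right hxy))⟩

lemma generateFrom_thresholdSets :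
    (inferInstance : MeasurableSpace X) = MeasurableSpace.generateFrom (thresholdSets X) := by
  apply le_antisymm
  · change MeasurableSpace.comap _ _ ≤ _
    rw [BorelSpace.measurable_eq (α := ℝ), borel_eq_generateFrom_Iic,
      MeasurableSpace.comap_generateFrom]
    refine MeasurableSpace.generateFrom_mono ?_
    rintro _ ⟨_, ⟨t, rfl⟩, rfl⟩
    refine ⟨measurable_subtype_coe measurableSet_Iic, {t}, fun x y hxy => ?_⟩
    exact (congrFun hxy ⟨t, by simp⟩).to_iff
  · exact MeasurableSpace.generateFrom_le fun E hE => hE.1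

lemma exists_factorsThrough_thresholdCell {ι : Type*} [Fintype ι] (μ : Measure X)
    [IsProbabilityMeasure μ] {g : X → ι} (hg : FiberMeasurable g) {ε : ℝ} (hε : 0 < ε) :
    ∃ (T : Finset ℝ) (D : X → Option ι), FactorsThrough D (thresholdCell T) ∧
      μ.real {x | D x ≠ some (g x)} < ε := by
  obtain ⟨x₀⟩ : Nonempty X := nonempty_of_isProbabilityMeasure μ
  have : Nonempty ι := ⟨g x₀⟩
  have hc : (0 : ℝ) < Fintype.card ι := by exact_mod_cast Fintype.card_pos
  have hdense := Measure.MeasureDense.of_generateFrom_isSetAlgebra_finite (μ := μ)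
    (isSetAlgebra_thresholdSets (X := X)) generateFrom_thresholdSets
  have happrox (i : ι) : ∃ E ∈ thresholdSets X,
      μ (symmDiff (g ⁻¹' {i}) E) < ENNReal.ofReal (ε / Fintype.card ι) :=
    hdense.approx _ (hg i) (measure_ne_top _ _) _ (by positivity)
  choose E hE hEμ using happrox
  choose T hT using fun i => (hE i).2
  let D : X → Option ι := fun x =>
    if h : ∃ i, x ∈ E i then some h.choose else none
  refine ⟨Finset.univ.biUnion T, D, fun x y hxy => ?_, ?_⟩
  · have hmem : (fun i => x ∈ E i) = fun i => y ∈ E i := funext fun i => propext <|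
      hT i x y (thresholdCell_eq_of_subset (Finset.subset_biUnion_of_mem T (Finset.mem_univ i)) hxy)
    have hchoose : ∀ P Q : ι → Prop, P = Q →
        (if h : ∃ i, P i then some h.choose else none) =
          if h : ∃ i, Q i then some h.choose else none := by
      rintro P _ rfl
      rfl
    exact hchoose _ _ hmem
  · have hsub : {x | D x ≠ some (g x)} ⊆ ⋃ i, symmDiff (g ⁻¹' {i}) (E i) := by
      intro x hx
      rw [mem_iUnion]
      by_cases hgx : x ∈ E (g x)
      · have h : ∃ i, x ∈ E i := ⟨_, hgx⟩
        have hD : D x = some h.choose := dif_pos h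
        refine ⟨h.choose, Or.inr ⟨h.choose_spec, fun hmem => hx ?_⟩⟩
        rw [hD, ← show g x = h.choose from hmem]
      · exact ⟨g x, Or.inl ⟨rfl, hgx⟩⟩
    calc μ.real {x | D x ≠ some (g x)}
        ≤ μ.real (⋃ i, symmDiff (g ⁻¹' {i}) (E i)) := measureReal_mono hsub
      _ ≤ ∑ i, μ.real (symmDiff (g ⁻¹' {i}) (E i)) := measureReal_iUnion_fintype_le _
      _ < ∑ _i : ι, ε / Fintype.card ι :=
          Finset.sum_lt_sum_of_nonempty Finset.univ_nonempty fun i _ =>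
            (ENNReal.lt_ofReal_iff_toReal_lt (measure_ne_top _ _)).1 (hEμ i)
      _ = ε := by
          simp only [Finset.sum_const, Finset.card_univ, nsmul_eq_mul]
          field_simp

lemma exists_fiberEntropy_option_lt {Ω : Type*} [MeasurableSpace Ω] (ι : Type*) [Fintype ι]
    (μ : Measure Ω) [IsProbabilityMeasure μ] {δ : ℝ} (hδ : 0 < δ) :
    ∃ ε > 0, ∀ e : Ω → Option ι, FiberMeasurable e → μ.real {x | e x ≠ none} < ε →
      fiberEntropy μ e < δ := by
  set c : ℝ := Fintype.card ι + 1 with hc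
  have hc0 : 0 < c := by positivity
  have h0 := Real.continuous_negMulLog.tendsto 0
  have h1 := Real.continuous_negMulLog.tendsto 1
  rw [Real.negMulLog_zero] at h0
  rw [Real.negMulLog_one] at h1
  obtain ⟨ε₀, hε₀, H₀⟩ := Metric.eventually_nhds_iff.1 (h0.eventually_lt_const (div_pos hδ hc0))
  obtain ⟨ε₁, hε₁, H₁⟩ := Metric.eventually_nhds_iff.1 (h1.eventually_lt_const (div_pos hδ hc0))
  refine ⟨min ε₀ ε₁, lt_min hε₀ hε₁, fun e he hμ => ?_⟩
  have hterm (o : Option ι) : Real.negMulLog (μ.real (e ⁻¹' {o})) < δ / c := by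
    cases o with
    | none =>
      apply H₁
      have hcompl : {x | e x ≠ none} = (e ⁻¹' {none})ᶜ := rfl
      rw [hcompl, probReal_compl_eq_one_sub (he none)] at hμ
      rw [Real.dist_eq, abs_sub_comm, abs_of_nonneg (sub_nonneg.2 measureReal_le_one)]
      exact hμ.trans_le (min_le_right _ _)
    | some i =>
      apply H₀
      rw [Real.dist_eq, sub_zero, abs_of_nonneg measureReal_nonneg]
      refine (measureReal_mono fun x hx => ?_).trans_lt (hμ.trans_le (min_le_left _ _))
      rw [mem_preimage, mem_singleton_iff] at hx
      simp [hx]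
  calc fiberEntropy μ e < ∑ _o : Option ι, δ / c :=
        Finset.sum_lt_sum_of_nonempty Finset.univ_nonempty fun o _ => hterm o
    _ = δ := by
        simp only [Finset.sum_const, Finset.card_univ, Fintype.card_option, nsmul_eq_mul]
        push_cast
        rw [← hc]
        field_simp

lemma exists_fiberEntropy_itinerary_le {ι : Type*} [Fintype ι] {μ : Measure X}
    [IsProbabilityMeasure μ] {f : X → X} (hf : MeasurePreserving f μ μ) {g : X → ι}
    (hg : FiberMeasurable g) {δ : ℝ} (hδ : 0 < δ) :
    ∃ T : Finset ℝ, ∀ n : ℕ, fiberEntropy μ (itinerary f g n) ≤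
      fiberEntropy μ (itinerary f (thresholdCell T) n) + n * δ := by
  obtain ⟨ε, hε, H⟩ := exists_fiberEntropy_option_lt ι μ hδ
  obtain ⟨T, D, hD, hDμ⟩ := exists_factorsThrough_thresholdCell μ hg hε
  have hT : FiberMeasurable (thresholdCell T : X → T → Prop) := fiberMeasurable_thresholdCell T
  let e : X → Option ι := fun x => if D x = some (g x) then none else some (g x)
  have he : FiberMeasurable e := by
    refine FiberMeasurable.of_factorsThrough (hT.prodMk hg) fun x y hxy => ?_
    rw [Prod.mk.injEq] at hxy
    simp only [e, hD hxy.1, hxy.2]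
  have hee : fiberEntropy μ e < δ := by
    refine H e he (lt_of_eq_of_lt ?_ hDμ)
    congr 1
    ext x
    by_cases h : D x = some (g x) <;> simp [e, h]
  refine ⟨T, fun n => ?_⟩
  have hTn := hT.itinerary hf.measurable n
  have hen := he.itinerary hf.measurable n
  calc fiberEntropy μ (itinerary f g n)
      ≤ fiberEntropy μ fun x => (itinerary f (thresholdCell T) n x, itinerary f e n x) := by
        refine fiberEntropy_le_of_factorsThrough μ (hTn.prodMk hen) fun x y hxy => ?_
        rw [Prod.mk.injEq] at hxy
        funext j
        have h₁ : D (f^[j] x) = D (f^[j] y) := hD (congrFun hxy.1 j)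
        have h₂ : e (f^[j] x) = e (f^[j] y) := congrFun hxy.2 j
        have h₃ : g (f^[j] x) = g (f^[j] y) := by
          by_cases hx : D (f^[j] x) = some (g (f^[j] x)) <;>
            by_cases hy : D (f^[j] y) = some (g (f^[j] y)) <;>
            simp_all [e]
        exact h₃
    _ ≤ fiberEntropy μ (itinerary f (thresholdCell T) n) + fiberEntropy μ (itinerary f e n) :=
        fiberEntropy_prodMk_le μ hTn hen
    _ ≤ fiberEntropy μ (itinerary f (thresholdCell T) n) + n * δ := by
        gcongr
        exact (fiberEntropy_itinerary_le hf he n).trans (by gcongr)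

end Approximation

section Partition

variable {X : Set ℝ}

lemma partEntropy_image_fiber {ι : Type*} [Fintype ι] (μ : Measure X) (g : X → ι) :
    partEntropy μ (Finset.univ.image fun i => g ⁻¹' {i}) = fiberEntropy μ g := by
  rw [partEntropy, Finset.sum_image_of_pairwise_eq_zero]
  · rfl
  · intro i _ j _ hij h
    have : g ⁻¹' {i} = ∅ := by
      refine eq_empty_of_forall_notMem fun x hx => hij ?_
      have hx' : x ∈ g ⁻¹' {j} := h ▸ hx
      exact hx.symm.trans hx'
    simp [this]

lemma partEntropy_patPartition (μ : Measure X) (f : X → X) (d : ℕ) :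
    partEntropy μ (patPartition f d) = fiberEntropy μ (ordPattern f d) := by
  rw [← partEntropy_image_fiber]
  congr 1
  refine Finset.image_congr fun i _ => ?_
  ext x
  simp [ordPattern, funext_iff, Fin.ext_iff]

lemma dynRefine_image_fiber {ι : Type*} [Fintype ι] (f : X → X) (g : X → ι) (n : ℕ) :
    dynRefine f (Finset.univ.image fun i => g ⁻¹' {i}) n =
      Finset.univ.image fun i => itinerary f g n ⁻¹' {i} := by
  induction n with
  | zero =>
    ext S
    simp only [dynRefine, Finset.mem_singleton, Finset.mem_image, Finset.mem_univ, true_and]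
    constructor
    · rintro rfl
      exact ⟨Fin.elim0, by ext x; simp [eq_iff_true_of_subsingleton]⟩
    · rintro ⟨i, rfl⟩
      ext x
      simp [eq_iff_true_of_subsingleton]
  | succ n ih =>
    have hfib (i : Fin n → ι) (j : ι) : itinerary f g (n + 1) ⁻¹' {Fin.snoc i j} =
        itinerary f g n ⁻¹' {i} ∩ f^[n] ⁻¹' (g ⁻¹' {j}) := by
      ext x
      simp only [mem_preimage, mem_singleton_iff, mem_inter_iff, funext_iff, itinerary,
        Fin.forall_fin_succ', Fin.snoc_castSucc, Fin.snoc_last, Fin.val_castSucc, Fin.val_last]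
    rw [dynRefine, ih]
    ext S
    simp only [Finset.mem_image, Finset.mem_product, Finset.mem_univ, true_and, Prod.exists]
    constructor
    · rintro ⟨_, _, ⟨⟨i, rfl⟩, _, ⟨j, rfl⟩, rfl⟩, rfl⟩
      exact ⟨Fin.snoc i j, hfib i j⟩
    · rintro ⟨i, rfl⟩
      refine ⟨_, _, ⟨⟨Fin.init i, rfl⟩, _, ⟨i (Fin.last n), rfl⟩, rfl⟩, ?_⟩
      rw [← hfib, Fin.snoc_init_self]

lemma IsFinPartition.exists_fiber {𝒜 : Finset (Set X)} (h𝒜 : IsFinPartition 𝒜) :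
    ∃ g : X → 𝒜, FiberMeasurable g ∧ (Finset.univ.image fun i => g ⁻¹' {i}) = 𝒜 := by
  obtain ⟨hmeas, hdisj, hcover⟩ := h𝒜
  have hex (x : X) : ∃ A : 𝒜, x ∈ A.1 := by
    obtain ⟨A, hA, hx⟩ : x ∈ ⋃₀ (𝒜 : Set (Set X)) := hcover ▸ mem_univ x
    exact ⟨⟨A, hA⟩, hx⟩
  choose g hgx using hex
  have hfib (A : 𝒜) : g ⁻¹' {A} = A := by
    ext x
    refine ⟨fun hx => by rw [← show g x = A from hx]; exact hgx x, fun hx => ?_⟩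
    by_contra hne
    exact disjoint_left.1 (hdisj _ (g x).2 _ A.2 fun h => hne (Subtype.ext h)) (hgx x) hx
  refine ⟨g, fun A => by rw [hfib]; exact hmeas A A.2, ?_⟩
  ext S
  simp [hfib]

end Partition

lemma ofReal_limsup_le_of_le {a b : ℕ → ℝ} (ha : ∀ n, 0 ≤ a n)
    (h : ∀ δ > 0, ∃ c : ℕ → ℝ, Tendsto c atTop (𝓝 0) ∧ ∀ᶠ n in atTop, a n ≤ b n / n + c n + δ) :
    ENNReal.ofReal (limsup a atTop) ≤
      limsup (fun n : ℕ => ENNReal.ofReal (b n) / (n : ℝ≥0∞)) atTop := by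
  set L := limsup (fun n : ℕ => ENNReal.ofReal (b n) / (n : ℝ≥0∞)) atTop with hL
  rcases eq_or_ne L ⊤ with hLtop | hLtop
  · simp [hLtop]
  rw [ENNReal.ofReal_le_iff_le_toReal hLtop]
  refine le_of_forall_pos_le_add fun ε hε => ?_
  obtain ⟨c, hc, hac⟩ := h (ε / 3) (by positivity)
  have hlt : L < ENNReal.ofReal (L.toReal + ε / 3) :=
    (ENNReal.lt_ofReal_iff_toReal_lt hLtop).2 (by linarith)
  refine limsup_le_of_le (IsCoboundedUnder.of_frequently_ge (a := 0) (Frequently.of_forall ha)) ?_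
  filter_upwards [hac, eventually_lt_of_limsup_lt hlt,
    hc.eventually_lt_const (show (0 : ℝ) < ε / 3 by positivity), eventually_gt_atTop 0]
    with n h₁ h₂ h₃ hn
  have hn' : (0 : ℝ) < n := by exact_mod_cast hn
  rw [← ENNReal.ofReal_natCast, ← ENNReal.ofReal_div_of_pos hn'] at h₂
  have h₄ := (ENNReal.ofReal_lt_ofReal_iff (by positivity)).1 h₂
  linarith

/-- For a continuous map on a compact set with invariant (not necessarily ergodic)
probability measure, the Kolmogorov-Sinai entropy does not exceed the permutation
entropy: `h_μ(f) ≤ h*_μ(f)`. -/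
theorem ksEntropy_le_permEntropy_compact_continuous
    {X : Set ℝ} (hX : IsCompact X) (f : X → X) (hcont : Continuous f)
    (μ : Measure X) [IsProbabilityMeasure μ] (hf : MeasurePreserving f μ μ) :
    ksEntropy μ f ≤ permEntropy μ f := by
  refine iSup₂_le fun 𝒜 h𝒜 => ?_
  obtain ⟨g, hg, hg𝒜⟩ := h𝒜.exists_fiber
  have hH (n : ℕ) : partEntropy μ (dynRefine f 𝒜 n) = fiberEntropy μ (itinerary f g n) := by
    rw [← partEntropy_image_fiber, ← dynRefine_image_fiber, hg𝒜]
  refine ofReal_limsup_le_of_le (fun n => ?_) fun δ hδ => ?_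
  · rw [hH]
    exact div_nonneg (fiberEntropy_nonneg μ _) n.cast_nonneg
  obtain ⟨T, hT⟩ := exists_fiberEntropy_itinerary_le hf hg hδ
  refine ⟨fun n => T.card * (Real.log (n + 2) / n), ?_, ?_⟩
  · have h := (Real.tendsto_pow_log_div_mul_add_atTop 1 (-2) 1 one_ne_zero).comp
      (tendsto_natCast_atTop_atTop.atTop_add (tendsto_const_nhds (x := (2 : ℝ))))
    simpa [comp_def] using h.const_mul (T.card : ℝ)
  · filter_upwards [eventually_gt_atTop 0] with n hn
    have hn' : (0 : ℝ) < n := by exact_mod_cast hn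
    have h := (hT n).trans
      (add_le_add_left (fiberEntropy_itinerary_thresholdCell_le hf.measurable μ T n) _)
    rw [hH, partEntropy_patPartition, div_le_iff₀ hn']
    refine h.trans_eq ?_
    field_simp
end
end

section
/- Let X ⊆ ℝ, let f : X → X be Borel measurable, let μ be an f-invariant Borel probability measure on X, and let d, n ∈ ℕ. Then H(P_{d+n}) ≥ H(⋁_{j=0}^{n−1} f^{−∘j}(P_d)), where H denotes the Shannon entropy with respect to μ. -/
open MeasureTheory Filter Set Function
open scoped Classical ENNReal Topology

noncomputable section

/-- The inversion numbers of a finite sequence determine the order relations between its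
terms. -/
lemma le_iff_le_of_card_filter_le_eq {α β : Type*} [LinearOrder α] [LinearOrder β]
    (z : ℕ → α) (w : ℕ → β) (D : ℕ)
    (h : ∀ l, 1 ≤ l → l ≤ D → ((Finset.range l).filter (fun r => z r ≤ z l)).card =
      ((Finset.range l).filter (fun r => w r ≤ w l)).card) :
    ∀ l ≤ D, ∀ r < l, (z r ≤ z l ↔ w r ≤ w l) := by
  intro l
  induction l using Nat.strong_induction_on with
  | _ l ih =>
    intro hl
    have hS : (Finset.range l).filter (fun r => z r ≤ z l) =
        (Finset.range l).filter (fun r => w r ≤ w l) := by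
      by_contra hne
      have hc := h l (by
        rcases Nat.eq_zero_or_pos l with rfl | h0
        · simp at hne
        · exact h0) hl
      have h1 : ¬ (Finset.range l).filter (fun r => z r ≤ z l) ⊆
          (Finset.range l).filter (fun r => w r ≤ w l) := fun hs =>
        hne (Finset.eq_of_subset_of_card_le hs hc.ge)
      have h2 : ¬ (Finset.range l).filter (fun r => w r ≤ w l) ⊆
          (Finset.range l).filter (fun r => z r ≤ z l) := fun hs =>
        hne (Finset.eq_of_subset_of_card_le hs hc.le).symm
      obtain ⟨r, hr, hr'⟩ := Finset.not_subset.1 h1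
      obtain ⟨s, hs, hs'⟩ := Finset.not_subset.1 h2
      simp only [Finset.mem_filter, Finset.mem_range, not_and, not_le] at hr hr' hs hs'
      have hz : z r < z s := hr.2.trans_lt (hs' hs.1)
      have hw : w s < w r := hs.2.trans_lt (hr' hr.1)
      rcases lt_trichotomy r s with hrs | rfl | hrs
      · exact hw.not_ge ((ih s hs.1 (by omega) r hrs).1 hz.le)
      · exact hz.false
      · exact hz.not_ge ((ih r hr.1 (by omega) s hrs).2 hw.le)
    intro r hr
    simpa [hr] using congrArg (r ∈ ·) hS

lemma iterate_le_iff_of_ordIdx_eq {X : Set ℝ} {f : X → X} {D : ℕ} {x y : X}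
    (h : ∀ l, 1 ≤ l → l ≤ D → ordIdx f D l x = ordIdx f D l y)
    {a b : ℕ} (hab : b < a) (ha : a ≤ D) :
    f^[a] x ≤ f^[b] x ↔ f^[a] y ≤ f^[b] y := by
  have := le_iff_le_of_card_filter_le_eq (fun r => f^[D - r] x) (fun r => f^[D - r] y) D
    (fun l h1 h2 => by simpa only [ordIdx] using h l h1 h2)
    (D - b) (by omega) (D - a) (by omega)
  simpa only [Nat.sub_sub_self ha, Nat.sub_sub_self (hab.le.trans ha)] using this

lemma ordIdx_iterate_eq_of_ordIdx_eq {X : Set ℝ} {f : X → X} {D d j : ℕ} (hD : d + j ≤ D)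
    {x y : X} (h : ∀ l, 1 ≤ l → l ≤ D → ordIdx f D l x = ordIdx f D l y)
    {l : ℕ} (hl : l ≤ d) : ordIdx f d l (f^[j] x) = ordIdx f d l (f^[j] y) := by
  unfold ordIdx
  congr 1
  refine Finset.filter_congr fun r hr => ?_
  simp only [← iterate_add_apply]
  have hr := Finset.mem_range.1 hr
  exact iterate_le_iff_of_ordIdx_eq h (by omega) (by omega)

lemma measurable_ordIdx {X : Set ℝ} {f : X → X} (hf : Measurable f) (d l : ℕ) :
    Measurable (ordIdx f d l) := by
  have : ordIdx f d l =
      fun x => ∑ r ∈ Finset.range l, if f^[d - r] x ≤ f^[d - l] x then 1 else 0 := by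
    ext x
    simp only [ordIdx, Finset.card_filter]
  rw [this]
  exact Finset.measurable_fun_sum _ fun r _ =>
    Measurable.ite (measurableSet_le (hf.iterate _) (hf.iterate _))
      measurable_const measurable_const

lemma pairwise_disjoint_patPartition {X : Set ℝ} (f : X → X) (d : ℕ) :
    (patPartition f d : Set (Set X)).Pairwise Disjoint := by
  intro A hA B hB hne
  simp only [patPartition, Finset.coe_image, Finset.coe_univ, Set.image_univ,
    Set.mem_range] at hA hB
  obtain ⟨i, rfl⟩ := hA
  obtain ⟨k, rfl⟩ := hB
  refine Set.disjoint_left.2 fun x hx hx' => hne ?_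
  have : i = k := funext fun l => Fin.ext ((hx l).symm.trans (hx' l))
  rw [this]

lemma isFinPartition_patPartition {X : Set ℝ} {f : X → X} (hf : Measurable f) (d : ℕ) :
    IsFinPartition (patPartition f d) := by
  refine ⟨fun A hA => ?_, fun A hA B hB hne => pairwise_disjoint_patPartition f d hA hB hne,
    Set.eq_univ_of_forall fun x => ?_⟩
  · simp only [patPartition, Finset.mem_image, Finset.mem_univ, true_and] at hA
    obtain ⟨i, rfl⟩ := hA
    simp only [Set.ofPred_forall]
    exact MeasurableSet.iInter fun l =>
      measurable_ordIdx hf d (l.val + 1) (measurableSet_singleton (i l).val)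
  · refine ⟨{y | ∀ l : Fin d, ordIdx f d (l.val + 1) y = ordIdx f d (l.val + 1) x}, ?_,
      fun l => rfl⟩
    simp only [patPartition, Finset.coe_image, Finset.coe_univ, Set.image_univ, Set.mem_range]
    refine ⟨fun l => ⟨ordIdx f d (l.val + 1) x, ?_⟩, rfl⟩
    have := Finset.card_filter_le (Finset.range (l.val + 1))
      (fun r => f^[d - r] x ≤ f^[d - (l.val + 1)] x)
    rw [Finset.card_range] at this
    exact Nat.lt_succ_of_le this

lemma ordIdx_eq_of_mem_patPartition {X : Set ℝ} {f : X → X} {d : ℕ} {B : Set X}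
    (hB : B ∈ patPartition f d) {x y : X} (hx : x ∈ B) (hy : y ∈ B) {l : ℕ}
    (h1 : 1 ≤ l) (hl : l ≤ d) : ordIdx f d l x = ordIdx f d l y := by
  simp only [patPartition, Finset.mem_image, Finset.mem_univ, true_and] at hB
  obtain ⟨i, rfl⟩ := hB
  have hx := hx ⟨l - 1, by omega⟩
  have hy := hy ⟨l - 1, by omega⟩
  simp only [Nat.sub_add_cancel h1] at hx hy
  exact hx.trans hy.symm

lemma mem_patPartition_of_ordIdx_eq {X : Set ℝ} {f : X → X} {d : ℕ} {A : Set X}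
    (hA : A ∈ patPartition f d) {x y : X} (hx : x ∈ A)
    (h : ∀ l ≤ d, ordIdx f d l x = ordIdx f d l y) : y ∈ A := by
  simp only [patPartition, Finset.mem_image, Finset.mem_univ, true_and] at hA
  obtain ⟨i, rfl⟩ := hA
  exact fun l => (h _ l.isLt).symm.trans (hx l)

lemma pairwise_disjoint_dynRefine {X : Set ℝ} (f : X → X) {𝒜 : Finset (Set X)}
    (h𝒜 : (𝒜 : Set (Set X)).Pairwise Disjoint) (n : ℕ) :
    (dynRefine f 𝒜 n : Set (Set X)).Pairwise Disjoint := by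
  induction n with
  | zero => simp [dynRefine]
  | succ n ih =>
    intro A hA B hB hne
    simp only [dynRefine, Finset.mem_coe, Finset.mem_image, Finset.mem_product,
      Prod.exists] at hA hB
    obtain ⟨A, _, ⟨hA, A', hA', rfl⟩, rfl⟩ := hA
    obtain ⟨B, _, ⟨hB, B', hB', rfl⟩, rfl⟩ := hB
    by_cases h : A = B
    · by_cases h' : A' = B'
      · exact absurd (by rw [h, h']) hne
      · exact ((h𝒜 hA' hB' h').preimage _).mono inter_subset_right inter_subset_right
    · exact (ih hA hB h).mono inter_subset_left inter_subset_left

lemma mem_dynRefine_of_forall_iterate {X : Set ℝ} {f : X → X} {𝒜 : Finset (Set X)}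
    {n : ℕ} {x y : X}
    (h : ∀ j < n, ∀ A ∈ 𝒜, f^[j] x ∈ A → f^[j] y ∈ A)
    {A : Set X} (hA : A ∈ dynRefine f 𝒜 n) (hx : x ∈ A) : y ∈ A := by
  induction n generalizing A with
  | zero =>
    obtain rfl : A = Set.univ := by simpa [dynRefine] using hA
    trivial
  | succ n ih =>
    simp only [dynRefine, Finset.mem_image, Finset.mem_product, Prod.exists] at hA
    obtain ⟨A, _, ⟨hA, A', hA', rfl⟩, rfl⟩ := hA
    exact ⟨ih (fun j hj => h j (by omega)) hA hx.1, h n (by omega) A' hA' hx.2⟩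

lemma negMulLog_sum_le {ι : Type*} (s : Finset ι) (a : ι → ℝ) (ha : ∀ i ∈ s, 0 ≤ a i) :
    Real.negMulLog (∑ i ∈ s, a i) ≤ ∑ i ∈ s, Real.negMulLog (a i) := by
  simp only [Real.negMulLog, neg_mul, Finset.sum_neg_distrib, neg_le_neg_iff]
  rw [Finset.sum_mul]
  refine Finset.sum_le_sum fun i hi => ?_
  rcases (ha i hi).eq_or_lt with h | h
  · simp [← h]
  · exact mul_le_mul_of_nonneg_left
      (Real.log_le_log h (Finset.single_le_sum ha hi)) h.le

/-- Refining a finite measurable partition does not decrease its entropy. -/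
lemma partEntropy_le_of_refines {X : Set ℝ} (μ : Measure X) [IsProbabilityMeasure μ]
    {𝒜 ℬ : Finset (Set X)} (h𝒜 : (𝒜 : Set (Set X)).Pairwise Disjoint)
    (hℬ : IsFinPartition ℬ)
    (h : ∀ A ∈ 𝒜, ∀ B ∈ ℬ, ∀ x ∈ B, ∀ y ∈ B, x ∈ A → y ∈ A) :
    partEntropy μ 𝒜 ≤ partEntropy μ ℬ := by
  obtain ⟨hm, hd, hc⟩ := hℬ
  have hsum (A : Set X) : (μ A).toReal = ∑ B ∈ ℬ, (μ (A ∩ B)).toReal := by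
    rw [← ENNReal.toReal_sum fun B _ => measure_ne_top μ _]
    have hA : A ∩ ⋃ B ∈ ℬ, B = A := by
      rw [← Set.inter_univ A, ← hc, Set.sUnion_eq_biUnion]
      simp
    have := measure_biUnion_finset₀ (μ := μ.restrict A) (s := ℬ) (f := id)
      (fun B hB C hC hne => (hd B hB C hC hne).aedisjoint)
      (fun B hB => (hm B hB).nullMeasurableSet)
    congr 1
    simp only [id] at this
    rw [Measure.restrict_apply (Finset.measurableSet_biUnion _ hm), Set.inter_comm, hA] at this
    rw [this]
    exact Finset.sum_congr rfl fun B hB => by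
      rw [Measure.restrict_apply (hm B hB), Set.inter_comm]
  have hnn (B : Set X) : 0 ≤ Real.negMulLog (μ B).toReal :=
    Real.negMulLog_nonneg ENNReal.toReal_nonneg measureReal_le_one
  calc partEntropy μ 𝒜
      ≤ ∑ A ∈ 𝒜, ∑ B ∈ ℬ, Real.negMulLog (μ (A ∩ B)).toReal := by
        refine Finset.sum_le_sum fun A _ => ?_
        rw [hsum A]
        exact negMulLog_sum_le _ _ fun B _ => ENNReal.toReal_nonneg
    _ = ∑ B ∈ ℬ, ∑ A ∈ 𝒜, Real.negMulLog (μ (A ∩ B)).toReal := Finset.sum_comm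
    _ ≤ partEntropy μ ℬ := by
        refine Finset.sum_le_sum fun B hB => ?_
        by_cases hx : ∃ A ∈ 𝒜, (A ∩ B).Nonempty
        · obtain ⟨A, hA, x, hxA, hxB⟩ := hx
          rw [Finset.sum_eq_single A]
          · rw [Set.inter_eq_right.2 fun y hy => h A hA B hB x hxB y hy hxA]
          · intro A' hA' hne
            have : A' ∩ B = ∅ := by
              refine Set.eq_empty_of_forall_notMem fun y hy => ?_
              exact Set.disjoint_left.1 (h𝒜 hA' hA hne) hy.1 (h A hA B hB x hxB y hy.2 hxA)
            simp [this]
          · exact fun hA' => absurd hA hA'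
        · push Not at hx
          rw [Finset.sum_eq_zero fun A hA => by rw [hx A hA]; simp]
          exact hnn B

/-- `H(P_{d+n}) ≥ H(⋁_{j=0}^{n-1} f^{-∘j}(P_d))`: the Shannon entropy of the ordinal
pattern partition of order `d+n` dominates the entropy of the common refinement
`⋁_{j=0}^{n-1} f^{-∘j}(P_d)`. -/
theorem partEntropy_dynRefine_le
    {X : Set ℝ} (f : X → X) (hf : Measurable f)
    (μ : Measure X) [IsProbabilityMeasure μ] (hμ : MeasurePreserving f μ μ)
    (d n : ℕ) (hd : 1 ≤ d) (hn : 1 ≤ n) :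
    partEntropy μ (dynRefine f (patPartition f d) n)
      ≤ partEntropy μ (patPartition f (d + n)) := by
  refine partEntropy_le_of_refines μ
    (pairwise_disjoint_dynRefine f (pairwise_disjoint_patPartition f d) n)
    (isFinPartition_patPartition hf (d + n)) fun A hA B hB x hx y hy hxA => ?_
  refine mem_dynRefine_of_forall_iterate (fun j hj C hC hxC => ?_) hA hxA
  exact mem_patPartition_of_ordIdx_eq hC hxC fun l hl =>
    ordIdx_iterate_eq_of_ordIdx_eq (by omega)
      (fun l h1 h2 => ordIdx_eq_of_mem_patPartition hB hx hy h1 h2) hl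
end
end
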